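/- arXiv:2303.14852 — 2 statements merged into one kernel-verified Lean document; each statement's English description precedes it below -/
import Mathlib

section
/- Let s ∈ ℤ and write s = qe + r with q, r ∈ ℤ and 0 ≤ r < e. Then the relative invariant exponents of π^s·𝒪_K in 𝒪_K over ℤ_p are s_{ℤ_p}(𝒪_K, π^s·𝒪_K) = (q with multiplicity d − rf, q+1 with multiplicity rf). -/
theorem aux_multiset (q : ℤ) (m : Multiset ℤ) (h : ∀ x ∈ m, x = q ∨ x = q + 1) :
    ∃ k j : ℕ, m = Multiset.replicate j q + Multiset.replicate k (q + 1) := by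
  induction m using Multiset.induction_on with
  | empty => exact ⟨0, 0, by simp⟩
  | cons a m ih =>
    obtain ⟨k, j, hkj⟩ := ih (fun x hx => h x (Multiset.mem_cons_of_mem hx))
    rcases h a (Multiset.mem_cons_self a m) with rfl | rfl
    · exact ⟨k, j + 1, by rw [hkj, Multiset.replicate_succ, Multiset.cons_add]⟩
    · exact ⟨k + 1, j, by rw [hkj, Multiset.replicate_succ, Multiset.add_cons]⟩

theorem aux_repr (p : ℕ) [Fact (Nat.Prime p)] {K : Type} [Field K] [Algebra ℚ_[p] K]
    [Algebra ℤ_[p] K] [IsScalarTower ℤ_[p] ℚ_[p] K] {d : ℕ}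
    (B : Module.Basis (Fin d) ℚ_[p] K) (x : K)
    (hx : x ∈ Submodule.span ℤ_[p] (Set.range B)) (i : Fin d) :
    ∃ z : ℤ_[p], (z : ℚ_[p]) = B.repr x i := by
  obtain ⟨z, hz⟩ := (B.mem_span_iff_repr_mem ℤ_[p] x).1 hx i
  exact ⟨z, hz⟩

theorem aux_det (p : ℕ) [Fact (Nat.Prime p)] {K : Type} [Field K] [Algebra ℚ_[p] K]
    [Algebra ℤ_[p] K] [IsScalarTower ℤ_[p] ℚ_[p] K] {d : ℕ}
    (B : Module.Basis (Fin d) ℚ_[p] K) (c : Fin d → K)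
    (hc : ∀ i, c i ∈ Submodule.span ℤ_[p] (Set.range B)) : ‖B.det c‖ ≤ 1 := by
  choose A hA using fun i j => aux_repr p B (c j) (hc j) i
  have : B.toMatrix c = (algebraMap ℤ_[p] ℚ_[p]).mapMatrix (Matrix.of A) := by
    ext i j
    exact (hA i j).symm
  rw [Module.Basis.det_apply, this, ← RingHom.map_det]
  exact PadicInt.norm_le_one _

theorem aux_norm_le (p : ℕ) [Fact (Nat.Prime p)] {K : Type} [Field K] [Algebra ℚ_[p] K]
    [FiniteDimensional ℚ_[p] K]
    [Algebra ℤ_[p] K] [IsScalarTower ℤ_[p] ℚ_[p] K] (x : K) (hx : IsIntegral ℤ_[p] x) :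
    ‖Algebra.norm ℚ_[p] x‖ ≤ 1 := by
  have h := Algebra.isIntegral_norm ℚ_[p] hx
  obtain ⟨z, hz⟩ := IsIntegrallyClosed.isIntegral_iff.1 h
  rw [← hz]
  exact PadicInt.norm_le_one _

theorem aux_zpow (p : ℕ) [Fact (Nat.Prime p)] {n : ℤ} (h : ‖(p : ℚ_[p]) ^ n‖ ≤ 1) : 0 ≤ n := by
  have := (Padic.norm_le_one_iff_val_nonneg _).1 h
  simpa using this

theorem aux_norm_pi (p : ℕ) [Fact (Nat.Prime p)] {K : Type} [Field K] [Algebra ℚ_[p] K]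
    [FiniteDimensional ℚ_[p] K]
    [Algebra ℤ_[p] K] [IsScalarTower ℤ_[p] ℚ_[p] K] (d e f : ℕ)
    (hd : Module.finrank ℚ_[p] K = d) (he : e ≠ 0) (hef : d = e * f) (π u v : K)
    (hu : IsIntegral ℤ_[p] u) (hv : IsIntegral ℤ_[p] v) (huv : u * v = 1)
    (hp : (p : K) = u * π ^ e) :
    ‖Algebra.norm ℚ_[p] π‖ = ‖(p : ℚ_[p])‖ ^ f := by
  have h1 : ‖Algebra.norm ℚ_[p] u‖ = 1 := by
    have a := aux_norm_le p u hu
    have b := aux_norm_le p v hv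
    have c : ‖Algebra.norm ℚ_[p] u‖ * ‖Algebra.norm ℚ_[p] v‖ = 1 := by
      rw [← norm_mul, ← map_mul, huv]; simp
    nlinarith [norm_nonneg (Algebra.norm ℚ_[p] u), norm_nonneg (Algebra.norm ℚ_[p] v)]
  have h2 : Algebra.norm ℚ_[p] (p : K) = (p : ℚ_[p]) ^ d := by
    have := Algebra.norm_algebraMap (R := ℚ_[p]) (S := K) (p : ℚ_[p])
    rwa [map_natCast, hd] at this
  have h3 : ‖(p : ℚ_[p])‖ ^ d = ‖Algebra.norm ℚ_[p] π‖ ^ e := by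
    rw [← norm_pow, ← h2, hp, map_mul, norm_mul, h1, map_pow, norm_pow, one_mul]
  rw [hef, mul_comm, pow_mul] at h3
  exact (pow_left_inj₀ (norm_nonneg _) (by positivity) he).1 h3.symm

theorem aux_prod {F ι : Type} [Field F] (x : F) (hx : x ≠ 0) (t : Finset ι) (σ : ι → ℤ) :
    ∏ i ∈ t, x ^ σ i = x ^ ∑ i ∈ t, σ i := by
  classical
  induction t using Finset.induction_on with
  | empty => simp
  | insert a t ha ih => rw [Finset.prod_insert ha, Finset.sum_insert ha, ih, zpow_add₀ hx]

theorem aux_norm_zpow {F K : Type} [Field F] [Field K] [Algebra F K] [FiniteDimensional F K]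
    (x : K) (n : ℤ) : Algebra.norm F (x ^ n) = Algebra.norm F x ^ n := by
  refine map_zpow' (Algebra.norm F) (fun y => ?_) x n
  by_cases hy : y = 0
  · rw [hy, inv_zero, Algebra.norm_zero, inv_zero]
  · apply eq_inv_of_mul_eq_one_right
    rw [← map_mul, mul_inv_cancel₀ hy, map_one]

theorem aux_uniq (p : ℕ) [Fact (Nat.Prime p)] {K : Type} [Field K] [Algebra ℚ_[p] K]
    [FiniteDimensional ℚ_[p] K]
    [Algebra ℤ_[p] K] [IsScalarTower ℤ_[p] ℚ_[p] K] (d e f : ℕ)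
    (hd : Module.finrank ℚ_[p] K = d) (hef : d = e * f) (π : K) (hπ0 : π ≠ 0)
    (hN : ‖Algebra.norm ℚ_[p] π‖ = ‖(p : ℚ_[p])‖ ^ f)
    (OK : Submodule ℤ_[p] K)
    (s : ℤ) (q : ℤ) (r : ℕ) (hs : s = q * (e : ℤ) + (r : ℤ))
    (M : Submodule ℤ_[p] K)
    (hM : ∀ x, x ∈ M ↔ ∃ y ∈ OK, x = π ^ s * y)
    (hM1 : ∀ x ∈ M, ∃ y ∈ OK, x = (p : ℚ_[p]) ^ q • y)
    (hM2 : ∀ y ∈ OK, (p : ℚ_[p]) ^ (q + 1) • y ∈ M)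
    (b : Fin d → K) (σ : Fin d → ℤ)
    (hb : LinearIndependent ℤ_[p] b) (hbs : Submodule.span ℤ_[p] (Set.range b) = OK)
    (hb's : Submodule.span ℤ_[p] (Set.range fun i => ((p : ℚ_[p]) ^ (σ i)) • b i) = M) :
    Multiset.map σ Finset.univ.val =
        Multiset.replicate (d - r * f) q + Multiset.replicate (r * f) (q + 1) := by
  have hp0 : (p : ℚ_[p]) ≠ 0 := by exact_mod_cast (Fact.out : p.Prime).ne_zero
  have hbQ : LinearIndependent ℚ_[p] b := (LinearIndependent.iff_fractionRing ℤ_[p] ℚ_[p]).1 hb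
  by_cases hd0 : d = 0
  · exfalso
    have : 0 < Module.finrank ℚ_[p] K := Module.finrank_pos
    omega
  have : Nonempty (Fin d) := ⟨⟨0, Nat.pos_of_ne_zero hd0⟩⟩
  let B : Module.Basis (Fin d) ℚ_[p] K := basisOfLinearIndependentOfCardEqFinrank hbQ (by simp [hd])
  have hB : ⇑B = b := coe_basisOfLinearIndependentOfCardEqFinrank _ _
  let w : Fin d → ℚ_[p]ˣ := fun i => Units.mk0 ((p : ℚ_[p]) ^ σ i) (zpow_ne_zero _ hp0)
  let B' : Module.Basis (Fin d) ℚ_[p] K := B.unitsSMul w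
  have hB' : ⇑B' = fun i => ((p : ℚ_[p]) ^ (σ i)) • b i := by
    ext i
    simp [B', Module.Basis.unitsSMul_apply, hB, w, Units.smul_def]
  have hπs : π ^ s ≠ 0 := zpow_ne_zero _ hπ0
  let L : K ≃ₗ[ℚ_[p]] K := LinearEquiv.ofBijective (LinearMap.mulLeft ℚ_[p] (π ^ s))
    ⟨fun x y h => mul_left_cancel₀ hπs h, fun y => ⟨(π ^ s)⁻¹ * y, by simp [hπs]⟩⟩
  let C : Module.Basis (Fin d) ℚ_[p] K := B.map L
  have hC : ⇑C = fun i => π ^ s * b i := by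
    ext i
    rw [← hB]
    rfl
  have hCs : Submodule.span ℤ_[p] (Set.range C) = M := by
    have : Set.range C = (LinearMap.mulLeft ℤ_[p] (π ^ s)) '' Set.range b := by
      rw [hC, ← Set.range_comp]; rfl
    rw [this, Submodule.span_image, hbs]
    ext x
    rw [hM, Submodule.mem_map]
    exact ⟨fun ⟨y, hy, h⟩ => ⟨y, hy, h.symm⟩, fun ⟨y, hy, h⟩ => ⟨y, hy, h.symm⟩⟩
  have hB's : Submodule.span ℤ_[p] (Set.range B') = M := by rw [hB', hb's]
  have hBs : Submodule.span ℤ_[p] (Set.range B) = OK := by rw [hB, hbs]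
  have d1 : ‖B'.det C‖ ≤ 1 := aux_det p B' C fun i => by
    rw [hB's, ← hCs]; exact Submodule.subset_span ⟨i, rfl⟩
  have d2 : ‖C.det B'‖ ≤ 1 := aux_det p C B' fun i => by
    rw [hCs, ← hB's]; exact Submodule.subset_span ⟨i, rfl⟩
  have d3 : B'.det C * C.det B' = 1 := by
    rw [Module.Basis.det_apply, Module.Basis.det_apply, ← Matrix.det_mul,
      Module.Basis.toMatrix_mul_toMatrix, Module.Basis.toMatrix_self, Matrix.det_one]
  have d4 : ‖B'.det C‖ = 1 := by
    have c : ‖B'.det C‖ * ‖C.det B'‖ = 1 := by rw [← norm_mul, d3, norm_one]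
    nlinarith [norm_nonneg (B'.det C), norm_nonneg (C.det B')]
  have d5 : B.det C = B.det B' * B'.det C := by
    rw [Module.Basis.det_apply, Module.Basis.det_apply, Module.Basis.det_apply, ← Matrix.det_mul,
      Module.Basis.toMatrix_mul_toMatrix]
  have d6 : B.det C = Algebra.norm ℚ_[p] (π ^ s) := by
    have := B.det_comp (LinearMap.mulLeft ℚ_[p] (π ^ s)) B
    rw [B.det_self, mul_one] at this
    rw [Algebra.norm_apply]
    have hCB : ⇑C = LinearMap.mulLeft ℚ_[p] (π ^ s) ∘ B := by rw [hC, ← hB]; rfl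
    rw [hCB, this]
    rfl
  have d7 : B.det B' = ∏ i, (p : ℚ_[p]) ^ σ i := by
    exact B.det_unitsSMul_self w
  have hp1 : ‖(p : ℚ_[p])‖ = (p : ℝ)⁻¹ := Padic.norm_p
  have hpgt : 1 < (p : ℝ) := by exact_mod_cast (Fact.out : p.Prime).one_lt
  have d8 : ∑ i, σ i = f * s := by
    have h1 : ‖∏ i, (p : ℚ_[p]) ^ σ i‖ = ‖(p : ℚ_[p])‖ ^ (f * s) := by
      rw [← d7, ← mul_one ‖B.det B'‖, ← d4, ← norm_mul, ← d5, d6, aux_norm_zpow, norm_zpow, hN, zpow_mul, zpow_natCast]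
    rw [aux_prod _ hp0, norm_zpow] at h1
    refine zpow_right_injective₀ (norm_pos_iff.2 hp0) ?_ h1
    rw [hp1]
    exact (inv_lt_one_of_one_lt₀ hpgt).ne
  have lo : ∀ i, q ≤ σ i := by
    intro i
    obtain ⟨y, hy, h⟩ := hM1 (B' i) (hB's ▸ Submodule.subset_span ⟨i, rfl⟩)
    obtain ⟨z, hz⟩ := aux_repr p B y (hBs ▸ hy) i
    have h2 : y = (p : ℚ_[p]) ^ (σ i - q) • B i := by
      rw [hB', ← hB] at h
      simp only at h
      rw [zpow_sub₀ hp0, div_eq_inv_mul, mul_smul, h, smul_smul, inv_mul_cancel₀ (zpow_ne_zero _ hp0), one_smul]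
    have h3 : B.repr y i = (p : ℚ_[p]) ^ (σ i - q) := by
      rw [h2]; simp
    have := aux_zpow p (n := σ i - q) (by rw [← h3, ← hz]; exact PadicInt.norm_le_one z)
    omega
  have hi : ∀ i, σ i ≤ q + 1 := by
    intro i
    have hm := hM2 (B i) (hBs ▸ Submodule.subset_span ⟨i, rfl⟩)
    obtain ⟨z, hz⟩ := aux_repr p B' _ (hB's ▸ hm) i
    have h2 : (p : ℚ_[p]) ^ (q + 1) • B i = (p : ℚ_[p]) ^ (q + 1 - σ i) • B' i := by
      rw [hB', ← hB]
      simp only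
      rw [smul_smul, ← zpow_add₀ hp0, sub_add_cancel]
    have h3 : B'.repr ((p : ℚ_[p]) ^ (q + 1) • B i) i = (p : ℚ_[p]) ^ (q + 1 - σ i) := by
      rw [h2]; simp
    have := aux_zpow p (n := q + 1 - σ i) (by rw [← h3, ← hz]; exact PadicInt.norm_le_one z)
    omega
  obtain ⟨k, j, hkj⟩ := aux_multiset q (Multiset.map σ Finset.univ.val) (by
    intro x hx
    obtain ⟨i, -, rfl⟩ := Multiset.mem_map.1 hx
    have := lo i
    have := hi i
    omega)
  have hcard := congrArg Multiset.card hkj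
  have hsum := congrArg Multiset.sum hkj
  simp at hcard
  have hsum' : ∑ i, σ i = j * q + k * (q + 1) := by
    rw [Multiset.sum_add, Multiset.sum_replicate, Multiset.sum_replicate] at hsum
    rw [nsmul_eq_mul, nsmul_eq_mul] at hsum
    exact hsum
  have hk : k = r * f := by
    have : (k : ℤ) = r * f := by
      have hc : (d : ℤ) = j + k := by exact_mod_cast hcard
      have he : (d : ℤ) = e * f := by exact_mod_cast hef
      rw [d8, hs] at hsum'
      linear_combination -hsum' - q * he + q * hc
    exact_mod_cast this
  rw [hkj, ← hk, hcard, Nat.add_sub_cancel]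

theorem aux_exist (p : ℕ) [Fact (Nat.Prime p)] {K : Type} [Field K] [Algebra ℚ_[p] K]
    [FiniteDimensional ℚ_[p] K]
    [Algebra ℤ_[p] K] [IsScalarTower ℤ_[p] ℚ_[p] K] (d : ℕ)
    (hd : Module.finrank ℚ_[p] K = d) (a : integralClosure ℤ_[p] K) (ha : a ≠ 0)
    (q : ℤ) (OK : Submodule ℤ_[p] K) (hOK : ∀ x, x ∈ OK ↔ x ∈ integralClosure ℤ_[p] K)
    (M : Submodule ℤ_[p] K)
    (hM : ∀ x, x ∈ M ↔ ∃ y ∈ OK, x = (p : ℚ_[p]) ^ q • ((a : K) * y)) :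
    ∃ (b : Fin d → K) (σ : Fin d → ℤ),
      (LinearIndependent ℤ_[p] b ∧ Submodule.span ℤ_[p] (Set.range b) = OK) ∧
      (LinearIndependent ℤ_[p] (fun i => ((p : ℚ_[p]) ^ (σ i)) • b i) ∧
        Submodule.span ℤ_[p] (Set.range fun i => ((p : ℚ_[p]) ^ (σ i)) • b i) = M) := by
  have hp0 : (p : ℚ_[p]) ≠ 0 := by exact_mod_cast (Fact.out : p.Prime).ne_zero
  have : Module.IsTorsionFree ℤ_[p] K := Module.IsTorsionFree.trans_faithfulSMul ℤ_[p] ℚ_[p] K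
  have : IsNoetherian ℤ_[p] (integralClosure ℤ_[p] K) :=
    IsIntegralClosure.isNoetherian ℤ_[p] ℚ_[p] K _
  have : Module.Free ℤ_[p] (integralClosure ℤ_[p] K) :=
    IsIntegralClosure.module_free ℤ_[p] ℚ_[p] K _
  have hrk : Module.finrank ℤ_[p] (integralClosure ℤ_[p] K) = d := by
    rw [IsIntegralClosure.rank ℤ_[p] ℚ_[p] K, hd]
  let B := Module.finBasisOfFinrankEq ℤ_[p] (integralClosure ℤ_[p] K) hrk
  obtain ⟨b', c, ab', h⟩ := Ideal.exists_smith_normal_form B (Ideal.span {a}) (by simpa using ha)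
  have hc : ∀ i, c i ≠ 0 := by
    intro i h0
    have := h i
    rw [h0, zero_smul] at this
    exact ab'.ne_zero i (Subtype.ext this)
  have key : ∀ i, (p : ℚ_[p]) ^ (q + (c i).valuation) • (b' i : K)
      = ((PadicInt.unitCoeff (hc i))⁻¹ : ℤ_[p]ˣ).1 • ((p : ℚ_[p]) ^ q • ((ab' i : integralClosure ℤ_[p] K) : K)) := by
    intro i
    have hci := PadicInt.unitCoeff_spec (hc i)
    have h1 : ((ab' i : integralClosure ℤ_[p] K) : K) = (c i) • (b' i : K) := by
      rw [h i]; rfl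
    have h2 : (p : ℤ_[p]) ^ (c i).valuation • (b' i : K) = (p : ℚ_[p]) ^ ((c i).valuation : ℤ) • (b' i : K) := by
      rw [zpow_natCast, ← IsScalarTower.algebraMap_smul ℚ_[p] ((p : ℤ_[p]) ^ (c i).valuation) (b' i : K)]
      simp
    have h3 : ((PadicInt.unitCoeff (hc i))⁻¹ : ℤ_[p]ˣ).1 • (c i) • (b' i : K) = (p : ℚ_[p]) ^ ((c i).valuation : ℤ) • (b' i : K) := by
      rw [← h2, smul_smul]
      congr 1
      exact (Units.inv_mul_eq_iff_eq_mul _).2 hci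
    rw [smul_comm, h1, h3, zpow_add₀ hp0, mul_smul]
  have hlin : LinearIndependent ℤ_[p] (fun i => (b' i : K)) :=
    b'.linearIndependent.map' (integralClosure ℤ_[p] K).val.toLinearMap
      (LinearMap.ker_eq_bot.2 Subtype.val_injective)
  have hspan : Submodule.span ℤ_[p] (Set.range (fun i => (b' i : K))) = OK := by
    have : Set.range (fun i => (b' i : K)) = (integralClosure ℤ_[p] K).val.toLinearMap '' Set.range b' := by
      rw [← Set.range_comp]; rfl
    rw [this, Submodule.span_image, b'.span_eq]
    ext x
    simp [hOK]
  refine ⟨fun i => b' i, fun i => q + (c i).valuation, ⟨hlin, hspan⟩, ?_, ?_⟩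
  · have hQ := (LinearIndependent.iff_fractionRing ℤ_[p] ℚ_[p]).1 hlin
    have := hQ.units_smul (fun i => Units.mk0 ((p : ℚ_[p]) ^ (q + ((c i).valuation : ℤ))) (zpow_ne_zero _ hp0))
    exact (LinearIndependent.iff_fractionRing ℤ_[p] ℚ_[p]).2 this
  · apply le_antisymm
    · rw [Submodule.span_le]
      rintro _ ⟨i, rfl⟩
      simp only
      rw [key]
      refine M.smul_mem _ ((hM _).2 ?_)
      obtain ⟨y, hy⟩ := Ideal.mem_span_singleton'.1 (ab' i).2
      exact ⟨y, (hOK _).2 y.2, by rw [← hy, mul_comm]; rfl⟩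
    · intro x hx
      obtain ⟨y, hy, rfl⟩ := (hM x).1 hx
      set N := Submodule.span ℤ_[p] (Set.range fun i => ((p : ℚ_[p]) ^ (q + ((c i).valuation : ℤ))) • (b' i : K)) with hN
      have hI : a * ⟨y, (hOK _).1 hy⟩ ∈ Ideal.span {a} := Ideal.mul_mem_right _ _ (Ideal.mem_span_singleton_self a)
      let φ : Ideal.span {a} →ₗ[ℤ_[p]] K :=
        { toFun := fun z => (p : ℚ_[p]) ^ q • ((z : integralClosure ℤ_[p] K) : K)
          map_add' := fun z w => by simp [smul_add]
          map_smul' := fun t z => by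
            exact smul_comm _ t _ }
      have : LinearMap.range φ ≤ N := by
        rw [LinearMap.range_eq_map, ← ab'.span_eq, Submodule.map_span, Submodule.span_le]
        rintro _ ⟨_, ⟨i, rfl⟩, rfl⟩
        have k1 : φ (ab' i) = (PadicInt.unitCoeff (hc i)).1 • ((p : ℚ_[p]) ^ (q + ((c i).valuation : ℤ)) • (b' i : K)) := by
          rw [key, smul_smul]; simp [φ]
        rw [SetLike.mem_coe, k1]
        exact N.smul_mem _ (Submodule.subset_span ⟨i, rfl⟩)
      exact this ⟨⟨_, hI⟩, rfl⟩

/-- Let `K` be a finite extension of `ℚ_p` of degree `d`, ramification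
index `e` and inertia degree `f`, with ring of integers `𝒪_K = integralClosure ℤ_[p] K` and
uniformizer `π`.  Let `s ∈ ℤ` and write `s = q·e + r` with `0 ≤ r < e`.  Regard `𝒪_K` and
`π^s·𝒪_K` as full `ℤ_p`-lattices in `K`.  Then the relative invariant exponents
`s_{ℤ_p}(𝒪_K, π^s·𝒪_K)` — the multiset `(σ i)` for which some `ℤ_p`-basis `(b i)` of `𝒪_K`
makes `(p^{σ i} • b i)` a `ℤ_p`-basis of `π^s·𝒪_K` (any such multiset, as it is independent
of the choice) — equal `(q` with multiplicity `d - r·f`, `q+1` with multiplicity `r·f)`. -/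
theorem stmt_16 (p : ℕ) [Fact (Nat.Prime p)]
    (K : Type) [Field K] [Algebra ℚ_[p] K] [FiniteDimensional ℚ_[p] K]
    [Algebra ℤ_[p] K] [IsScalarTower ℤ_[p] ℚ_[p] K]
    (d e f : ℕ) (hd : Module.finrank ℚ_[p] K = d)
    (π : K) (hπ : π ∈ integralClosure ℤ_[p] K)
    (hπirr : Irreducible (⟨π, hπ⟩ : integralClosure ℤ_[p] K))
    (he : ∃ u : (integralClosure ℤ_[p] K)ˣ,
      (p : integralClosure ℤ_[p] K) = ↑u * (⟨π, hπ⟩ : integralClosure ℤ_[p] K) ^ e)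
    (hef : d = e * f)
    -- `𝒪_K` and `π^s 𝒪_K` as `ℤ_p`-submodules of `K`
    (OK : Submodule ℤ_[p] K) (hOK : (OK : Set K) = {x : K | x ∈ integralClosure ℤ_[p] K})
    (s : ℤ) (q : ℤ) (r : ℕ) (hs : s = q * (e : ℤ) + (r : ℤ)) (hr : r < e)
    (M : Submodule ℤ_[p] K)
    (hM : (M : Set K) = {x : K | ∃ y ∈ integralClosure ℤ_[p] K, x = π ^ s * y}) :
    -- the multiset of invariant exponents is realized ...
    (∃ (b : Fin d → K) (σ : Fin d → ℤ),
      (LinearIndependent ℤ_[p] b ∧ Submodule.span ℤ_[p] (Set.range b) = OK) ∧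
      (LinearIndependent ℤ_[p] (fun i => ((p : ℚ_[p]) ^ (σ i)) • b i) ∧
        Submodule.span ℤ_[p] (Set.range fun i => ((p : ℚ_[p]) ^ (σ i)) • b i) = M) ∧
      Multiset.map σ Finset.univ.val =
        Multiset.replicate (d - r * f) q + Multiset.replicate (r * f) (q + 1)) ∧
    -- ... and every realization gives the same multiset:
    (∀ (b : Fin d → K) (σ : Fin d → ℤ),
      (LinearIndependent ℤ_[p] b ∧ Submodule.span ℤ_[p] (Set.range b) = OK) →
      (LinearIndependent ℤ_[p] (fun i => ((p : ℚ_[p]) ^ (σ i)) • b i) ∧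
        Submodule.span ℤ_[p] (Set.range fun i => ((p : ℚ_[p]) ^ (σ i)) • b i) = M) →
      Multiset.map σ Finset.univ.val =
        Multiset.replicate (d - r * f) q + Multiset.replicate (r * f) (q + 1)) := by
  have hp0 : (p : ℚ_[p]) ≠ 0 := by exact_mod_cast (Fact.out : p.Prime).ne_zero
  have hpK : (p : K) ≠ 0 := by
    have := (map_ne_zero (algebraMap ℚ_[p] K)).2 hp0
    rwa [map_natCast] at this
  have hsm : ∀ (n : ℤ) (x : K), (p : ℚ_[p]) ^ n • x = (p : K) ^ n * x := by
    intro n x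
    rw [Algebra.smul_def, map_zpow₀, map_natCast]
  obtain ⟨u, hu⟩ := he
  have he0 : e ≠ 0 := by omega
  have hpi : (p : K) = ((u : integralClosure ℤ_[p] K) : K) * π ^ e := by
    have := congrArg (fun z : integralClosure ℤ_[p] K => (z : K)) hu
    simpa using this
  have huv : ((u : integralClosure ℤ_[p] K) : K) * ((u⁻¹ : (integralClosure ℤ_[p] K)ˣ) : integralClosure ℤ_[p] K) = 1 := by
    exact congrArg (fun z : integralClosure ℤ_[p] K => (z : K)) u.mul_inv
  have hπ0 : π ≠ 0 := by
    rintro rfl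
    rw [zero_pow he0, mul_zero] at hpi
    exact hpK hpi
  have hN := aux_norm_pi p d e f hd he0 hef π _ _ u.1.2 (u⁻¹).1.2 huv hpi
  have hOK' : ∀ x, x ∈ OK ↔ x ∈ integralClosure ℤ_[p] K := fun x => by
    rw [← SetLike.mem_coe, hOK]; rfl
  have hM' : ∀ x, x ∈ M ↔ ∃ y ∈ OK, x = π ^ s * y := fun x => by
    rw [← SetLike.mem_coe, hM]
    simp only [hOK', Set.mem_ofPred_eq]
  have hu0 : ((u : integralClosure ℤ_[p] K) : K) ≠ 0 := left_ne_zero_of_mul_eq_one huv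
  have huz : ∀ n : ℤ, ((u : integralClosure ℤ_[p] K) : K) ^ n ∈ integralClosure ℤ_[p] K := by
    have hinv : ((u : integralClosure ℤ_[p] K) : K)⁻¹ ∈ integralClosure ℤ_[p] K := by
      rw [← eq_inv_of_mul_eq_one_right huv]
      exact (u⁻¹).1.2
    intro n
    obtain ⟨k, rfl | rfl⟩ := n.eq_nat_or_neg
    · rw [zpow_natCast]; exact pow_mem u.1.2 k
    · rw [zpow_neg, zpow_natCast, ← inv_pow]; exact pow_mem hinv k
  have hps : (p : K) ^ q * π ^ r = ((u : integralClosure ℤ_[p] K) : K) ^ q * π ^ s := by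
    rw [hpi, mul_zpow, hs, zpow_add₀ hπ0, mul_comm q, zpow_mul, zpow_natCast, zpow_natCast, mul_assoc]
  have hM'' : ∀ x, x ∈ M ↔ ∃ y ∈ OK, x = (p : ℚ_[p]) ^ q • (π ^ r * y) := by
    intro x
    rw [hM']
    constructor
    · rintro ⟨y, hy, rfl⟩
      refine ⟨((u : integralClosure ℤ_[p] K) : K) ^ (-q) * y, (hOK' _).2 (mul_mem (huz _) ((hOK' _).1 hy)), ?_⟩
      rw [hsm, ← mul_assoc, hps, zpow_neg]
      field_simp
    · rintro ⟨y, hy, rfl⟩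
      refine ⟨((u : integralClosure ℤ_[p] K) : K) ^ q * y, (hOK' _).2 (mul_mem (huz _) ((hOK' _).1 hy)), ?_⟩
      rw [hsm, ← mul_assoc, hps]
      ring
  have hM1 : ∀ x ∈ M, ∃ y ∈ OK, x = (p : ℚ_[p]) ^ q • y := by
    intro x hx
    obtain ⟨y, hy, rfl⟩ := (hM'' x).1 hx
    exact ⟨π ^ r * y, (hOK' _).2 (mul_mem (pow_mem hπ r) ((hOK' _).1 hy)), rfl⟩
  have hM2 : ∀ y ∈ OK, (p : ℚ_[p]) ^ (q + 1) • y ∈ M := by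
    intro y hy
    refine (hM'' _).2 ⟨((u : integralClosure ℤ_[p] K) : K) * π ^ (e - r) * y,
      (hOK' _).2 (mul_mem (mul_mem u.1.2 (pow_mem hπ _)) ((hOK' _).1 hy)), ?_⟩
    rw [hsm, hsm, zpow_add₀ hpK, zpow_one, mul_assoc]
    congr 1
    have : π ^ e = π ^ r * π ^ (e - r) := by rw [← pow_add]; congr 1; omega
    rw [hpi, this]
    ring
  have huniq := fun b σ h1 h2 h3 => aux_uniq p d e f hd hef π hπ0 hN OK s q r hs M hM' hM1 hM2 b σ h1 h2 h3
  refine ⟨?_, fun b σ h1 h2 => huniq b σ h1.1 h1.2 h2.2⟩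
  obtain ⟨b, σ, h1, h2⟩ := aux_exist p d hd ((⟨π, hπ⟩ : integralClosure ℤ_[p] K) ^ r)
    (pow_ne_zero _ hπirr.ne_zero) q OK hOK' M (by simpa using hM'')
  exact ⟨b, σ, h1, h2, huniq b σ h1.1 h1.2 h2.2⟩
end

section
/- Let B be a maximal proper ℤ_p-submodule of 𝒪_K (equivalently, a ℤ_p-submodule of additive index p). Then: (1) if π𝒪_K ⊆ B, then s_{ℤ_p}(B, π𝒪_K) = (0 with multiplicity d−f+1, 1 with multiplicity f−1); (2) if π𝒪_K ⊄ B, then s_{ℤ_p}(B, π𝒪_K) = (−1 with multiplicity 1, 0 with multiplicity d−f−1, 1 with multiplicity f). -/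
theorem aux_index_pow (p : ℕ) [Fact p.Prime] (n : ℕ) :
    (Ideal.span {(p : ℤ_[p]) ^ n}).toAddSubgroup.index = p ^ n := by
  have h : (Ideal.span {(p : ℤ_[p]) ^ n}).toAddSubgroup =
      (PadicInt.toZModPow (p := p) n).toAddMonoidHom.ker := by
    ext x
    have := PadicInt.ker_toZModPow (p := p) n
    rw [Submodule.mem_toAddSubgroup, ← this]
    rfl
  have hs : Function.Surjective (PadicInt.toZModPow (p := p) n).toAddMonoidHom :=
    ZMod.ringHom_surjective (PadicInt.toZModPow (p := p) n)
  rw [h, AddSubgroup.index_ker, AddMonoidHom.range_eq_top.2 hs]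
  simp

theorem aux_relIndex {p : ℕ} [Fact p.Prime] {K : Type} [AddCommGroup K] [Module ℤ_[p] K]
    {d : ℕ} (b : Fin d → K) (n : Fin d → ℕ) (N : Submodule ℤ_[p] K)
    (h : ∀ a : Fin d → ℤ_[p], ∑ i, a i • b i ∈ N ↔ ∀ i, (p : ℤ_[p]) ^ n i ∣ a i) :
    N.toAddSubgroup.relIndex (Submodule.span ℤ_[p] (Set.range b)).toAddSubgroup
      = p ^ ∑ i, n i := by
  let φ := (Fintype.linearCombination ℤ_[p] b)
  have h1 : (Submodule.span ℤ_[p] (Set.range b)).toAddSubgroup =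
      AddSubgroup.map φ.toAddMonoidHom ⊤ := by
    ext x
    rw [Submodule.mem_toAddSubgroup, ← Fintype.range_linearCombination]
    simp only [AddSubgroup.mem_map, AddSubgroup.mem_top, true_and]
    rfl
  have h2 : AddSubgroup.comap φ.toAddMonoidHom N.toAddSubgroup =
      AddSubgroup.pi Set.univ (fun i => (Ideal.span {(p : ℤ_[p]) ^ n i}).toAddSubgroup) := by
    ext a
    rw [AddSubgroup.mem_pi]
    simp only [AddSubgroup.mem_comap, Submodule.mem_toAddSubgroup, Set.mem_univ, true_imp_iff,
      Ideal.mem_span_singleton]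
    rw [← h a]
    rfl
  rw [h1, ← AddSubgroup.relIndex_comap, h2, AddSubgroup.relIndex_top_right, AddSubgroup.index_pi]
  simp only [aux_index_pow]
  rw [Finset.prod_pow_eq_pow_sum]

theorem aux_dvd {p : ℕ} [Fact p.Prime] (σ : ℤ) (a : ℤ_[p]) :
    (p : ℤ_[p]) ^ σ.toNat ∣ a ↔ ∃ c : ℤ_[p], (a : ℚ_[p]) = (c : ℚ_[p]) * (p : ℚ_[p]) ^ σ := by
  have hp : (p : ℚ_[p]) ≠ 0 := by
    have := (Fact.out : p.Prime).ne_zero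
    exact_mod_cast this
  rcases le_total 0 σ with h | h
  · obtain ⟨n, rfl⟩ := Int.eq_ofNat_of_zero_le h
    simp only [Int.toNat_natCast, zpow_natCast]
    constructor
    · rintro ⟨c, rfl⟩
      exact ⟨c, by push_cast; ring⟩
    · rintro ⟨c, hc⟩
      refine ⟨c, ?_⟩
      apply Subtype.coe_injective
      push_cast
      rw [hc]; ring
  · rw [Int.toNat_of_nonpos h]
    simp only [pow_zero, one_dvd, true_iff]
    obtain ⟨n, hn⟩ := Int.eq_ofNat_of_zero_le (neg_nonneg.2 h)
    refine ⟨a * p ^ n, ?_⟩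
    have : σ = -(n : ℤ) := by omega
    subst this
    push_cast
    rw [zpow_neg, zpow_natCast, mul_assoc, mul_inv_cancel₀ (pow_ne_zero _ hp), mul_one]

theorem aux_mem {p : ℕ} [Fact p.Prime] {K : Type} [Field K] [Algebra ℚ_[p] K]
    [Algebra ℤ_[p] K] [IsScalarTower ℤ_[p] ℚ_[p] K] {d : ℕ} (b : Fin d → K) (σ : Fin d → ℤ)
    (hb : LinearIndependent ℤ_[p] b) (a : Fin d → ℤ_[p]) :
    ∑ i, a i • b i ∈ Submodule.span ℤ_[p] (Set.range fun i => ((p : ℚ_[p]) ^ (σ i)) • b i) ↔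
      ∀ i, (p : ℤ_[p]) ^ (σ i).toNat ∣ a i := by
  have hb' : LinearIndependent ℚ_[p] b := (LinearIndependent.iff_fractionRing ℤ_[p] ℚ_[p]).1 hb
  have hsm : ∀ (c : ℤ_[p]) (x : K), c • x = (c : ℚ_[p]) • x := fun c x =>
    (algebraMap_smul ℚ_[p] c x).symm
  simp only [aux_dvd]
  rw [Submodule.mem_span_range_iff_exists_fun]
  constructor
  · rintro ⟨c, hc⟩ i
    refine ⟨c i, ?_⟩
    have : ∑ i, ((c i : ℚ_[p]) * (p : ℚ_[p]) ^ σ i) • b i = ∑ i, (a i : ℚ_[p]) • b i := by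
      simpa only [hsm, smul_smul] using hc
    exact (congrFun (hb'.fintypeLinearCombination_injective (by
      simpa [Fintype.linearCombination_apply] using this)) i).symm
  · intro h
    choose c hc using h
    refine ⟨c, ?_⟩
    simp only [hsm, smul_smul, hc]

theorem aux_key {p : ℕ} [Fact p.Prime] {K : Type} [Field K] [Algebra ℚ_[p] K]
    [Algebra ℤ_[p] K] [IsScalarTower ℤ_[p] ℚ_[p] K] {d : ℕ} (b : Fin d → K) (σ : Fin d → ℤ)
    (hb : LinearIndependent ℤ_[p] b) (B P : Submodule ℤ_[p] K)
    (hB : Submodule.span ℤ_[p] (Set.range b) = B)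
    (hP : Submodule.span ℤ_[p] (Set.range fun i => ((p : ℚ_[p]) ^ (σ i)) • b i) = P)
    (hpB : ∀ x ∈ B, (p : ℤ_[p]) • x ∈ P) :
    P.toAddSubgroup.relIndex B.toAddSubgroup = p ^ ∑ i, (σ i).toNat ∧ ∀ i, σ i ≤ 1 := by
  subst hB hP
  refine ⟨aux_relIndex b _ _ (aux_mem b σ hb), fun i => ?_⟩
  have h := hpB (b i) (Submodule.subset_span ⟨i, rfl⟩)
  have h2 := (aux_mem b σ hb (Pi.single i (p : ℤ_[p]))).1 (by
    simpa [Pi.single_apply, ite_smul] using h) i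
  rw [Pi.single_eq_same] at h2
  have h3 : (σ i).toNat ≤ 1 := by
    rw [← pow_dvd_pow_iff (a := (p : ℤ_[p])) PadicInt.prime_p.ne_zero PadicInt.prime_p.not_isUnit]
    simpa using h2
  omega

theorem aux_multiset_s17 (s : Multiset ℤ) (h : ∀ x ∈ s, -1 ≤ x ∧ x ≤ 1) :
    ∃ k, s = Multiset.replicate (s.map fun x => (-x).toNat).sum (-1) +
      (Multiset.replicate k 0 + Multiset.replicate (s.map fun x => x.toNat).sum 1) := by
  induction s using Multiset.induction_on with
  | empty => exact ⟨0, by simp⟩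
  | cons a s ih =>
    obtain ⟨k, hk⟩ := ih fun x hx => h x (Multiset.mem_cons_of_mem hx)
    obtain ⟨h1, h2⟩ := h a (Multiset.mem_cons_self a s)
    rw [Multiset.map_cons, Multiset.map_cons, Multiset.sum_cons, Multiset.sum_cons]
    generalize (s.map fun x => (-x).toNat).sum = A at *
    generalize (s.map fun x => x.toNat).sum = C at *
    subst hk
    have : a = -1 ∨ a = 0 ∨ a = 1 := by omega
    rcases this with rfl | rfl | rfl
    · exact ⟨k, by simp [Multiset.replicate_add]⟩
    · exact ⟨k + 1, by simp [Multiset.replicate_add]⟩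
    · exact ⟨k, by simp [Multiset.replicate_add]⟩

theorem aux_count {d : ℕ} (σ : Fin d → ℤ) (h1 : ∀ i, σ i ≤ 1) (h2 : ∀ i, - σ i ≤ 1) (A C : ℕ)
    (hA : ∑ i, (σ i).toNat = A) (hC : ∑ i, (- σ i).toNat = C) :
    Multiset.map σ Finset.univ.val = Multiset.replicate C (-1) +
      (Multiset.replicate (d - A - C) 0 + Multiset.replicate A 1) := by
  obtain ⟨k, hk⟩ := aux_multiset_s17 (Multiset.map σ Finset.univ.val) (by
    intro x hx
    obtain ⟨i, -, rfl⟩ := Multiset.mem_map.1 hx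
    exact ⟨by have := h2 i; omega, h1 i⟩)
  rw [Multiset.map_map, Multiset.map_map] at hk
  have e1 : (Multiset.map ((fun x : ℤ => (-x).toNat) ∘ σ) Finset.univ.val).sum = C := hC
  have e2 : (Multiset.map ((fun x : ℤ => x.toNat) ∘ σ) Finset.univ.val).sum = A := hA
  rw [e1, e2] at hk
  have hc := congrArg Multiset.card hk
  simp at hc
  rw [hk]
  congr 3
  omega

theorem aux_basis {R M ι : Type*} [CommRing R] [AddCommGroup M] [Module R M] (S : Submodule R M)
    (b : Module.Basis ι R S) : LinearIndependent R (fun i => (b i : M)) ∧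
      Submodule.span R (Set.range fun i => (b i : M)) = S := by
  constructor
  · exact b.linearIndependent.map' S.subtype S.ker_subtype
  · have := b.span_eq
    have h2 := congrArg (Submodule.map S.subtype) this
    rw [Submodule.map_span, ← Set.range_comp, Submodule.map_top, Submodule.range_subtype] at h2
    exact h2

theorem aux_exists {p : ℕ} [Fact p.Prime] {K : Type} [Field K] [Algebra ℚ_[p] K]
    [Algebra ℤ_[p] K] [IsScalarTower ℤ_[p] ℚ_[p] K] {d : ℕ} (B P : Submodule ℤ_[p] K)
    (bB : Module.Basis (Fin d) ℤ_[p] B) (hPd : Module.finrank ℤ_[p] P = d)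
    (hpP : ∀ x ∈ P, (p : ℤ_[p]) • x ∈ B) :
    ∃ (b : Fin d → K) (σ : Fin d → ℤ),
        (LinearIndependent ℤ_[p] b ∧ Submodule.span ℤ_[p] (Set.range b) = B) ∧
        (LinearIndependent ℤ_[p] (fun i => ((p : ℚ_[p]) ^ (σ i)) • b i) ∧
          Submodule.span ℤ_[p] (Set.range fun i => ((p : ℚ_[p]) ^ (σ i)) • b i) = P) := by
  have hp : (p : ℚ_[p]) ≠ 0 := by
    have := (Fact.out : p.Prime).ne_zero
    exact_mod_cast this
  have hsm : ∀ (c : ℤ_[p]) (x : K), c • x = (c : ℚ_[p]) • x := fun c x =>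
    (algebraMap_smul ℚ_[p] c x).symm
  let φ : P →ₗ[ℤ_[p]] B := LinearMap.codRestrict B ((p : ℤ_[p]) • P.subtype) (fun x => hpP x x.2)
  have hφ : ∀ x, ((φ x : B) : K) = (p : ℚ_[p]) • (x : K) := by
    intro x
    have : ((φ x : B) : K) = (p : ℤ_[p]) • (x : K) := rfl
    rw [this, hsm]; simp
  have hinj : Function.Injective φ := by
    intro x y hxy
    have := congrArg (Subtype.val) hxy
    rw [hφ, hφ] at this
    exact Subtype.ext (smul_right_injective K hp this)
  let ψ := LinearEquiv.ofInjective φ hinj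
  have hr : Module.finrank ℤ_[p] (LinearMap.range φ) = Module.finrank ℤ_[p] B := by
    rw [← ψ.finrank_eq, hPd, Module.finrank_eq_card_basis bB, Fintype.card_fin]
  obtain ⟨bM, a, bN, hsnf⟩ := Submodule.exists_smith_normal_form_of_rank_eq bB hr
  have ha : ∀ i, a i ≠ 0 := by
    intro i h0
    have := hsnf i
    rw [h0, zero_smul] at this
    exact bN.ne_zero i (Subtype.ext this)
  let b' := bM.unitsSMul (fun i => PadicInt.unitCoeff (ha i))
  let bP := bN.map ψ.symm
  have hbP : ∀ i, ((p : ℚ_[p]) ^ (((a i).valuation : ℤ) - 1)) • ((b' i : B) : K) = (bP i : K) := by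
    intro i
    have h1 : ψ (bP i) = bN i := by simp [bP]
    have h2 : ((φ (bP i) : B) : K) = a i • (bM i : K) := by
      have : φ (bP i) = (bN i : B) := by rw [← h1]; rfl
      rw [this, hsnf]; rfl
    rw [hφ] at h2
    have h3 : ((b' i : B) : K) = (PadicInt.unitCoeff (ha i) : ℤ_[p]) • (bM i : K) := by
      simp only [b', Module.Basis.unitsSMul_apply]; rfl
    apply smul_right_injective K hp
    dsimp only
    rw [h2, h3, hsm, hsm, smul_smul, smul_smul, zpow_sub_one₀ hp]
    congr 1
    conv_rhs => rw [PadicInt.unitCoeff_spec (ha i)]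
    push_cast
    rw [zpow_natCast]
    field_simp
  refine ⟨fun i => (b' i : K), fun i => ((a i).valuation : ℤ) - 1, aux_basis B b', ?_⟩
  simp only [hbP]
  exact aux_basis P bP


theorem aux_coatom {p : ℕ} [Fact p.Prime] {K : Type} [AddCommGroup K] [Module ℤ_[p] K]
    (OK B : Submodule ℤ_[p] K) (hBlt : B < OK)
    (hBmax : ∀ B' : Submodule ℤ_[p] K, B < B' → B' ≤ OK → B' = OK) :
    B.toAddSubgroup.relIndex OK.toAddSubgroup = p ∧ ∀ x ∈ OK, (p : ℤ_[p]) • x ∈ B := by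
  have hc : B ⋖ OK := by
    refine ⟨hBlt, fun C h1 h2 => ?_⟩
    exact h2.ne (hBmax C h1 h2.le)
  have hs := (covBy_iff_quot_is_simple hBlt.le).1 hc
  obtain ⟨I, hI, ⟨eqv⟩⟩ := isSimpleModule_iff_quot_maximal.1 hs
  have hI' : I = IsLocalRing.maximalIdeal ℤ_[p] := IsLocalRing.eq_maximalIdeal hI
  subst hI'
  constructor
  · have h1 : B.toAddSubgroup.relIndex OK.toAddSubgroup =
        Nat.card (OK ⧸ Submodule.comap OK.subtype B) := rfl
    rw [h1, Nat.card_congr eqv.toEquiv]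
    have h2 := Nat.card_congr (PadicInt.residueField (p := p)).toEquiv
    rw [Nat.card_zmod] at h2
    exact h2
  · intro x hx
    have h3 : (p : ℤ_[p]) • (Submodule.Quotient.mk (p := Submodule.comap OK.subtype B) ⟨x, hx⟩) = 0 := by
      apply eqv.injective
      rw [map_smul, map_zero]
      obtain ⟨y, hy⟩ := Ideal.Quotient.mk_surjective
        (eqv (Submodule.Quotient.mk (p := Submodule.comap OK.subtype B) ⟨x, hx⟩))
      rw [← hy, ← Ideal.Quotient.mk_eq_mk, ← Submodule.Quotient.mk_smul,
        Submodule.Quotient.mk_eq_zero, smul_eq_mul, PadicInt.maximalIdeal_eq_span_p]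
      exact Ideal.mul_mem_right _ _ (Ideal.mem_span_singleton_self _)
    rw [← Submodule.Quotient.mk_smul, Submodule.Quotient.mk_eq_zero] at h3
    exact h3

theorem aux_pow {K : Type} [Field K] (O : AddSubgroup K) (π : K) (h0 : π ≠ 0)
    (hO : ∀ x ∈ O, π * x ∈ O) (k : ℕ) :
    (O.map (AddMonoidHom.mulLeft (π ^ k))).relIndex O =
      ((O.map (AddMonoidHom.mulLeft π)).relIndex O) ^ k := by
  have hpow : ∀ (k : ℕ), ∀ x ∈ O, π ^ k * x ∈ O := by
    intro k
    induction k with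
    | zero => intro x hx; simpa using hx
    | succ k ih => intro x hx; rw [pow_succ', mul_assoc]; exact hO _ (ih x hx)
  induction k with
  | zero =>
    have : O.map (AddMonoidHom.mulLeft (π ^ 0)) = O := by
      ext x; simp
    rw [this]; simp
  | succ k ih =>
    have h1 : O.map (AddMonoidHom.mulLeft (π ^ (k + 1))) =
        (O.map (AddMonoidHom.mulLeft (π ^ k))).map (AddMonoidHom.mulLeft π) := by
      rw [AddSubgroup.map_map]
      congr 1
      ext x
      simp [pow_succ', mul_assoc]
    have h2 : O.map (AddMonoidHom.mulLeft (π ^ k)) ≤ O := by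
      rintro _ ⟨x, hx, rfl⟩
      exact hpow k x hx
    have h3 : O.map (AddMonoidHom.mulLeft π) ≤ O := by
      rintro _ ⟨x, hx, rfl⟩
      exact hO x hx
    rw [h1, ← AddSubgroup.relIndex_mul_relIndex _ _ _ (AddSubgroup.map_mono h2) h3,
      AddSubgroup.relIndex_map_map_of_injective, ih, pow_succ]
    exact mul_right_injective₀ h0

theorem aux_rank {p : ℕ} [Fact p.Prime] {K : Type} [Field K] [Algebra ℚ_[p] K]
    [Algebra ℤ_[p] K] [IsScalarTower ℤ_[p] ℚ_[p] K] {d : ℕ} (O L : Submodule ℤ_[p] K)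
    (b : Module.Basis (Fin d) ℤ_[p] O) (h1 : L ≤ O) (h2 : ∀ x ∈ O, (p : ℤ_[p]) • x ∈ L) :
    Module.finrank ℤ_[p] L = d ∧ Nonempty (Module.Basis (Fin d) ℤ_[p] L) := by
  obtain ⟨n, bL⟩ := Submodule.basisOfPidOfLE h1 b
  have hp : (p : ℚ_[p]) ≠ 0 := by
    have := (Fact.out : p.Prime).ne_zero
    exact_mod_cast this
  have hsm : ∀ (x : K), (p : ℤ_[p]) • x = (p : ℚ_[p]) • x := fun x => by
    rw [← algebraMap_smul ℚ_[p] (p : ℤ_[p]) x]; simp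
  have : Module.Finite ℤ_[p] O := Module.Finite.of_basis b
  have : Module.Finite ℤ_[p] L := Module.Finite.of_basis bL
  have hO : Module.finrank ℤ_[p] O = d := by
    rw [Module.finrank_eq_card_basis b, Fintype.card_fin]
  have hL : Module.finrank ℤ_[p] L = n := by
    rw [Module.finrank_eq_card_basis bL, Fintype.card_fin]
  have i1 : n ≤ d := by
    rw [← hO, ← hL]
    exact LinearMap.finrank_le_finrank_of_injective (Submodule.inclusion_injective h1)
  let φ : O →ₗ[ℤ_[p]] L := LinearMap.codRestrict L ((p : ℤ_[p]) • O.subtype) (fun x => h2 x x.2)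
  have hinj : Function.Injective φ := by
    intro x y hxy
    have h := congrArg (Subtype.val) hxy
    have h' : (p : ℤ_[p]) • (x : K) = (p : ℤ_[p]) • (y : K) := h
    rw [hsm, hsm] at h'
    exact Subtype.ext (smul_right_injective K hp h')
  have i2 : d ≤ n := by
    rw [← hO, ← hL]
    exact LinearMap.finrank_le_finrank_of_injective hinj
  obtain rfl : n = d := le_antisymm i1 i2
  exact ⟨hL, ⟨bL⟩⟩

theorem aux_final {p : ℕ} [Fact p.Prime] {K : Type} [Field K] [Algebra ℚ_[p] K]
    [Algebra ℤ_[p] K] [IsScalarTower ℤ_[p] ℚ_[p] K] {d : ℕ} (B P : Submodule ℤ_[p] K) (A C : ℕ)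
    (hA : P.toAddSubgroup.relIndex B.toAddSubgroup = p ^ A)
    (hC : B.toAddSubgroup.relIndex P.toAddSubgroup = p ^ C)
    (hpB : ∀ x ∈ B, (p : ℤ_[p]) • x ∈ P) (hpP : ∀ x ∈ P, (p : ℤ_[p]) • x ∈ B)
    (b : Fin d → K) (σ : Fin d → ℤ)
    (h1 : LinearIndependent ℤ_[p] b ∧ Submodule.span ℤ_[p] (Set.range b) = B)
    (h2 : LinearIndependent ℤ_[p] (fun i => ((p : ℚ_[p]) ^ (σ i)) • b i) ∧
          Submodule.span ℤ_[p] (Set.range fun i => ((p : ℚ_[p]) ^ (σ i)) • b i) = P) :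
    Multiset.map σ Finset.univ.val = Multiset.replicate C (-1) +
      (Multiset.replicate (d - A - C) 0 + Multiset.replicate A 1) := by
  have hp : (p : ℚ_[p]) ≠ 0 := by
    have := (Fact.out : p.Prime).ne_zero
    exact_mod_cast this
  have hp1 : 1 < p := (Fact.out : p.Prime).one_lt
  obtain ⟨k1, k2⟩ := aux_key b σ h1.1 B P h1.2 h2.2 hpB
  obtain ⟨k3, k4⟩ := aux_key (fun i => ((p : ℚ_[p]) ^ (σ i)) • b i) (fun i => - σ i) h2.1 P B h2.2
    (by
      simp only [smul_smul, ← zpow_add₀ hp, neg_add_cancel, zpow_zero, one_smul]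
      exact h1.2) hpP
  rw [hA] at k1
  rw [hC] at k3
  exact aux_count σ k2 k4 A C (Nat.pow_right_injective hp1 k1).symm
    (Nat.pow_right_injective hp1 k3).symm


/-- Let `K` be a finite extension of `ℚ_p` of degree `d`, ramification
index `e` and inertia degree `f`, with ring of integers `𝒪_K = integralClosure ℤ_[p] K` and
uniformizer `π`, and let `B` be a maximal proper `ℤ_p`-submodule of `𝒪_K`.  Regarding `B`
and `π𝒪_K` as full `ℤ_p`-lattices in `K`, the relative invariant exponents
`s_{ℤ_p}(B, π𝒪_K)` — the multiset `(σ i)` for which some `ℤ_p`-basis `(b i)` of `B` makes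
`(p^{σ i} • b i)` a `ℤ_p`-basis of `π𝒪_K` — are:
`(0^{d-f+1}, 1^{f-1})` if `π𝒪_K ⊆ B`, and `(-1, 0^{d-f-1}, 1^f)` if `π𝒪_K ⊄ B`. -/
theorem stmt_17 (p : ℕ) [Fact (Nat.Prime p)]
    (K : Type) [Field K] [Algebra ℚ_[p] K] [FiniteDimensional ℚ_[p] K]
    [Algebra ℤ_[p] K] [IsScalarTower ℤ_[p] ℚ_[p] K]
    (d e f : ℕ) (hd : Module.finrank ℚ_[p] K = d)
    (π : K) (hπ : π ∈ integralClosure ℤ_[p] K)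
    (hπirr : Irreducible (⟨π, hπ⟩ : integralClosure ℤ_[p] K))
    (he : ∃ u : (integralClosure ℤ_[p] K)ˣ,
      (p : integralClosure ℤ_[p] K) = ↑u * (⟨π, hπ⟩ : integralClosure ℤ_[p] K) ^ e)
    (hef : d = e * f)
    -- `𝒪_K` and `π·𝒪_K` as `ℤ_p`-submodules of `K`
    (OK : Submodule ℤ_[p] K) (hOK : (OK : Set K) = {x : K | x ∈ integralClosure ℤ_[p] K})
    (P : Submodule ℤ_[p] K)
    (hP : (P : Set K) = {x : K | ∃ y ∈ integralClosure ℤ_[p] K, x = π * y})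
    -- `B` a maximal proper `ℤ_p`-submodule of `𝒪_K`
    (B : Submodule ℤ_[p] K) (hBlt : B < OK)
    (hBmax : ∀ B' : Submodule ℤ_[p] K, B < B' → B' ≤ OK → B' = OK) :
    -- case (1): `π𝒪_K ⊆ B`
    (P ≤ B →
      ((∃ (b : Fin d → K) (σ : Fin d → ℤ),
        (LinearIndependent ℤ_[p] b ∧ Submodule.span ℤ_[p] (Set.range b) = B) ∧
        (LinearIndependent ℤ_[p] (fun i => ((p : ℚ_[p]) ^ (σ i)) • b i) ∧
          Submodule.span ℤ_[p] (Set.range fun i => ((p : ℚ_[p]) ^ (σ i)) • b i) = P) ∧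
        Multiset.map σ Finset.univ.val =
          Multiset.replicate (d - f + 1) (0 : ℤ) + Multiset.replicate (f - 1) 1) ∧
      (∀ (b : Fin d → K) (σ : Fin d → ℤ),
        (LinearIndependent ℤ_[p] b ∧ Submodule.span ℤ_[p] (Set.range b) = B) →
        (LinearIndependent ℤ_[p] (fun i => ((p : ℚ_[p]) ^ (σ i)) • b i) ∧
          Submodule.span ℤ_[p] (Set.range fun i => ((p : ℚ_[p]) ^ (σ i)) • b i) = P) →
        Multiset.map σ Finset.univ.val =
          Multiset.replicate (d - f + 1) (0 : ℤ) + Multiset.replicate (f - 1) 1))) ∧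
    -- case (2): `π𝒪_K ⊄ B`
    (¬ P ≤ B →
      ((∃ (b : Fin d → K) (σ : Fin d → ℤ),
        (LinearIndependent ℤ_[p] b ∧ Submodule.span ℤ_[p] (Set.range b) = B) ∧
        (LinearIndependent ℤ_[p] (fun i => ((p : ℚ_[p]) ^ (σ i)) • b i) ∧
          Submodule.span ℤ_[p] (Set.range fun i => ((p : ℚ_[p]) ^ (σ i)) • b i) = P) ∧
        Multiset.map σ Finset.univ.val =
          (-1 : ℤ) ::ₘ (Multiset.replicate (d - f - 1) (0 : ℤ) + Multiset.replicate f 1)) ∧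
      (∀ (b : Fin d → K) (σ : Fin d → ℤ),
        (LinearIndependent ℤ_[p] b ∧ Submodule.span ℤ_[p] (Set.range b) = B) →
        (LinearIndependent ℤ_[p] (fun i => ((p : ℚ_[p]) ^ (σ i)) • b i) ∧
          Submodule.span ℤ_[p] (Set.range fun i => ((p : ℚ_[p]) ^ (σ i)) • b i) = P) →
        Multiset.map σ Finset.univ.val =
          (-1 : ℤ) ::ₘ (Multiset.replicate (d - f - 1) (0 : ℤ) + Multiset.replicate f 1)))) := by
  have hp : (p : ℚ_[p]) ≠ 0 := by
    have := (Fact.out : p.Prime).ne_zero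
    exact_mod_cast this
  have hpp : p.Prime := Fact.out
  have hsm : ∀ (x : K), (p : ℤ_[p]) • x = (p : K) * x := fun x => by
    rw [Algebra.smul_def]; simp
  have hmO : ∀ x, x ∈ OK ↔ x ∈ integralClosure ℤ_[p] K := fun x => Set.ext_iff.1 hOK x
  have hmP : ∀ x, x ∈ P ↔ ∃ y ∈ integralClosure ℤ_[p] K, x = π * y := fun x => Set.ext_iff.1 hP x
  have hd0 : 0 < d := hd ▸ Module.finrank_pos
  have he0 : 0 < e := Nat.pos_of_ne_zero (by rintro rfl; simp at hef; omega)
  have hf0 : 0 < f := Nat.pos_of_ne_zero (by rintro rfl; simp at hef; omega)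
  have hπ0 : π ≠ 0 := by
    rintro rfl
    exact hπirr.ne_zero rfl
  obtain ⟨u, hu⟩ := he
  have huK : (p : K) = (u : integralClosure ℤ_[p] K) * π ^ e := by
    have := congrArg (fun z : integralClosure ℤ_[p] K => (z : K)) hu
    simpa using this
  have huv : ((u : integralClosure ℤ_[p] K) : K) *
      ((u⁻¹ : (integralClosure ℤ_[p] K)ˣ) : integralClosure ℤ_[p] K) = 1 := by
    exact congrArg (fun z : integralClosure ℤ_[p] K => (z : K)) u.mul_inv
  -- basis of OK
  have hchar : CharZero ℚ_[p] := inferInstance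
  have : Algebra.IsSeparable ℚ_[p] K := inferInstance
  have hKtf : Module.IsTorsionFree ℤ_[p] K := Module.IsTorsionFree.trans_faithfulSMul ℤ_[p] ℚ_[p] K
  have hfree : Module.Free ℤ_[p] (integralClosure ℤ_[p] K) :=
    IsIntegralClosure.module_free ℤ_[p] ℚ_[p] K _
  have hfin : Module.Finite ℤ_[p] (integralClosure ℤ_[p] K) :=
    IsIntegralClosure.finite ℤ_[p] ℚ_[p] K _
  have hrk : Module.finrank ℤ_[p] (integralClosure ℤ_[p] K) = d := by
    rw [IsIntegralClosure.rank ℤ_[p] ℚ_[p] K, hd]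
  have hOeq : OK = Subalgebra.toSubmodule (integralClosure ℤ_[p] K) := by
    ext x; rw [hmO]; rfl
  have bO : Module.Basis (Fin d) ℤ_[p] OK := by
    rw [hOeq]
    exact Module.finBasisOfFinrankEq ℤ_[p] (integralClosure ℤ_[p] K) hrk
  obtain ⟨hBidx, hpOB⟩ := aux_coatom OK B hBlt hBmax
  have hPO : P ≤ OK := by
    intro x hx
    obtain ⟨y, hy, rfl⟩ := (hmP x).1 hx
    exact (hmO _).2 (mul_mem hπ hy)
  have hpOP : ∀ x ∈ OK, (p : ℤ_[p]) • x ∈ P := by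
    intro x hx
    rw [hmO] at hx
    rw [hmP, hsm]
    refine ⟨(u : integralClosure ℤ_[p] K) * π ^ (e - 1) * x,
      mul_mem (mul_mem (u : integralClosure ℤ_[p] K).2 (pow_mem hπ _)) hx, ?_⟩
    obtain ⟨k, rfl⟩ : ∃ k, e = k + 1 := ⟨e - 1, by omega⟩
    rw [huK, Nat.add_sub_cancel]; ring
  -- index of P in OK
  have hPmap : P.toAddSubgroup = OK.toAddSubgroup.map (AddMonoidHom.mulLeft π) := by
    ext x
    simp only [Submodule.mem_toAddSubgroup, AddSubgroup.mem_map, hmP, hmO,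
      AddMonoidHom.coe_mulLeft, eq_comm]
  have hidx1 := aux_pow OK.toAddSubgroup π hπ0 (fun x hx => by
    simp only [Submodule.mem_toAddSubgroup, hmO] at hx ⊢
    exact mul_mem hπ hx) e
  rw [← hPmap] at hidx1
  have hbb := aux_basis OK bO
  have hidx2 : (OK.toAddSubgroup.map (AddMonoidHom.mulLeft (π ^ e))).relIndex OK.toAddSubgroup
      = p ^ d := by
    have hm : OK.toAddSubgroup.map (AddMonoidHom.mulLeft (π ^ e)) =
        (Submodule.span ℤ_[p] (Set.range fun i : Fin d =>
          ((p : ℚ_[p]) ^ (1 : ℤ)) • (bO i : K))).toAddSubgroup := by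
      have h1 : (Set.range fun i : Fin d => ((p : ℚ_[p]) ^ (1 : ℤ)) • (bO i : K)) =
          (LinearMap.mulLeft ℤ_[p] (p : K)) '' (Set.range fun i => (bO i : K)) := by
        rw [← Set.range_comp]
        congr 1
        ext i
        simp [Algebra.smul_def]
      rw [h1, ← Submodule.map_span, hbb.2]
      ext x
      simp only [Submodule.mem_toAddSubgroup, AddSubgroup.mem_map, Submodule.mem_map, hmO,
        AddMonoidHom.coe_mulLeft, LinearMap.mulLeft_apply]
      constructor
      · rintro ⟨y, hy, rfl⟩
        refine ⟨((u⁻¹ : (integralClosure ℤ_[p] K)ˣ) : integralClosure ℤ_[p] K) * y,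
          mul_mem (Subtype.property _) hy, ?_⟩
        rw [huK]
        linear_combination (π ^ e * y) * huv
      · rintro ⟨y, hy, rfl⟩
        refine ⟨(u : integralClosure ℤ_[p] K) * y, mul_mem (Subtype.property _) hy, ?_⟩
        rw [huK]; ring
    have h2 := aux_relIndex (fun i => (bO i : K)) (fun _ => 1) _
      (aux_mem (fun i => (bO i : K)) (fun _ => 1) hbb.1)
    rw [hm]
    rw [hbb.2] at h2
    simpa using h2
  have hPidx : P.toAddSubgroup.relIndex OK.toAddSubgroup = p ^ f := by
    rw [hidx2, hef, mul_comm, pow_mul] at hidx1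
    exact (Nat.pow_left_injective he0.ne' hidx1).symm
  have hpB : ∀ x ∈ B, (p : ℤ_[p]) • x ∈ P := fun x hx => hpOP x (hBlt.le hx)
  have hpP : ∀ x ∈ P, (p : ℤ_[p]) • x ∈ B := fun x hx => hpOB x (hPO hx)
  obtain ⟨-, ⟨bB⟩⟩ := aux_rank OK B bO hBlt.le hpOB
  obtain ⟨hPd, -⟩ := aux_rank OK P bO hPO hpOP
  obtain ⟨b, σ, hb, hσ⟩ := aux_exists B P bB hPd hpP
  have hfd : f ≤ d := hef ▸ Nat.le_mul_of_pos_left f he0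
  constructor
  · intro hPB
    have hC : B.toAddSubgroup.relIndex P.toAddSubgroup = p ^ 0 := by
      rw [pow_zero, AddSubgroup.relIndex_eq_one]
      exact hPB
    have hA : P.toAddSubgroup.relIndex B.toAddSubgroup = p ^ (f - 1) := by
      have h := AddSubgroup.relIndex_mul_relIndex P.toAddSubgroup B.toAddSubgroup OK.toAddSubgroup
        hPB hBlt.le
      rw [hBidx, hPidx] at h
      obtain ⟨k, rfl⟩ : ∃ k, f = k + 1 := ⟨f - 1, by omega⟩
      rw [pow_succ] at h
      exact Nat.eq_of_mul_eq_mul_right hpp.pos h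
    have key : ∀ (b : Fin d → K) (σ : Fin d → ℤ),
        (LinearIndependent ℤ_[p] b ∧ Submodule.span ℤ_[p] (Set.range b) = B) →
        (LinearIndependent ℤ_[p] (fun i => ((p : ℚ_[p]) ^ (σ i)) • b i) ∧
          Submodule.span ℤ_[p] (Set.range fun i => ((p : ℚ_[p]) ^ (σ i)) • b i) = P) →
        Multiset.map σ Finset.univ.val =
          Multiset.replicate (d - f + 1) (0 : ℤ) + Multiset.replicate (f - 1) 1 := by
      intro b σ h1 h2
      have h := aux_final B P (f - 1) 0 hA hC hpB hpP b σ h1 h2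
      rw [h, show d - (f - 1) - 0 = d - f + 1 by omega]
      simp
    exact ⟨⟨b, σ, hb, hσ, key b σ hb hσ⟩, key⟩
  · intro hPB
    have hsup : B ⊔ P = OK := by
      refine hBmax _ ?_ (sup_le hBlt.le hPO)
      exact lt_of_le_of_ne le_sup_left (fun h => hPB (h ▸ le_sup_right))
    have hsup' : B.toAddSubgroup ⊔ P.toAddSubgroup = OK.toAddSubgroup := by
      rw [← Submodule.sup_toAddSubgroup, hsup]
    have hC : B.toAddSubgroup.relIndex P.toAddSubgroup = p ^ 1 := by
      rw [pow_one, ← AddSubgroup.relIndex_sup_left, hsup', hBidx]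
    have hA : P.toAddSubgroup.relIndex B.toAddSubgroup = p ^ f := by
      rw [← AddSubgroup.relIndex_sup_right, hsup', hPidx]
    have key : ∀ (b : Fin d → K) (σ : Fin d → ℤ),
        (LinearIndependent ℤ_[p] b ∧ Submodule.span ℤ_[p] (Set.range b) = B) →
        (LinearIndependent ℤ_[p] (fun i => ((p : ℚ_[p]) ^ (σ i)) • b i) ∧
          Submodule.span ℤ_[p] (Set.range fun i => ((p : ℚ_[p]) ^ (σ i)) • b i) = P) →
        Multiset.map σ Finset.univ.val =
          (-1 : ℤ) ::ₘ (Multiset.replicate (d - f - 1) (0 : ℤ) + Multiset.replicate f 1) := by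
      intro b σ h1 h2
      have h := aux_final B P f 1 hA hC hpB hpP b σ h1 h2
      rw [h]
      simp
    exact ⟨⟨b, σ, hb, hσ, key b σ hb hσ⟩, key⟩
end
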